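/- Let f_1,…,f_K be additive utility functions with strictly positive link costs, let S be a set of routes from SN to DN, and let x = [SN, r_1, …, r_m, DN] ∈ S with sub-route x' = [SN, r_1, …, r_m]. If x is Pareto-optimal in S (no route of S strongly dominates x), then no route x_d ∈ S weakly dominates the sub-route x', i.e. there is no x_d ∈ S with f(x_d) ≽ f(x'). (Pareto-optimal routes are guaranteed to have non-weakly-dominated sub-routes, because the sub-route strongly dominates its route, so any route weakly dominating the sub-route would strongly dominate the route itself.) -/

import Mathlib

/-- Additive route cost: the sum of the positive link costs over the
consecutive pairs (links) of the route. -/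
def routeCost {V : Type*} (w : V → V → ℝ) (x : List V) : ℝ :=
  ((x.zip x.tail).map fun p => w p.1 p.2).sum

/-- Strong Pareto dominance of utility vectors: `u ≻ v`. -/
def StrongDom {K : ℕ} (u v : Fin K → ℝ) : Prop :=
  ∀ k, u k < v k

/-- Weak Pareto dominance of utility vectors: `u ≽ v`. -/
def WeakDom {K : ℕ} (u v : Fin K → ℝ) : Prop :=
  (∀ k, u k ≤ v k) ∧ ∃ k, u k < v k

/-- A route `x` is Pareto-optimal in a set `S` of routes if no route of `S`
strongly dominates it. -/
def ParetoOptimalIn {V : Type*} {K : ℕ}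
    (f : List V → Fin K → ℝ) (S : Set (List V)) (x : List V) : Prop :=
  ∀ y ∈ S, ¬ StrongDom (f y) (f x)

theorem routeCost_lt_append {V : Type*} (w : V → V → ℝ) (hw : ∀ u v, 0 < w u v)
    (d : V) (rs : List V) : ∀ a : V,
    routeCost w (a :: rs) < routeCost w (a :: (rs ++ [d])) := by
  induction rs with
  | nil => intro a; simpa [routeCost] using hw a d
  | cons b t ih =>
    intro a
    have h := ih b
    simp only [routeCost, List.cons_append, List.tail_cons, List.zip_cons_cons,
      List.map_cons, List.sum_cons] at h ⊢
    linarith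

/-- If the route `x = [SN, r_1, …, r_m, DN] ∈ S` is Pareto-optimal in `S`,
then no route of `S` weakly dominates its sub-route `x' = [SN, r_1, …, r_m]`. -/
theorem stmt2 {V : Type*} {K : ℕ} (w : Fin K → V → V → ℝ)
    (hw : ∀ k u v, 0 < w k u v)
    (SN DN : V) (rs : List V) (S : Set (List V))
    (hxS : (SN :: (rs ++ [DN])) ∈ S)
    (hopt : ParetoOptimalIn (fun x k => routeCost (w k) x) S
      (SN :: (rs ++ [DN]))) :
    ¬ ∃ xd ∈ S, WeakDom (fun k => routeCost (w k) xd)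
      (fun k => routeCost (w k) (SN :: rs)) := by
  rintro ⟨xd, hxd, hle, _⟩
  exact hopt xd hxd fun k =>
    lt_of_le_of_lt (hle k) (routeCost_lt_append (w k) (hw k) DN rs SN)
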